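/- For every real z with |z| < 1, Σ_{k=0}^∞ u_k z^k = (2/((1+z)(2+z))) · (1 + (2 - γ - ψ(1-z)) z). -/

import Mathlib

/-- `u_k = Σ_{j=1}^∞ 2 / (j^k (j+1)(j+2))`. -/
noncomputable def u (k : ℕ) : ℝ :=
  ∑' j : ℕ, 2 / (((j : ℝ) + 1) ^ k * ((j : ℝ) + 2) * ((j : ℝ) + 3))

/-- The digamma function `ψ(x) = Γ'(x)/Γ(x)`. -/
noncomputable def digamma (x : ℝ) : ℝ := deriv Real.Gamma x / Real.Gamma x

theorem deriv_log_comp_Gamma {x : ℝ} (hx : 0 < x) :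
    deriv (Real.log ∘ Real.Gamma) x = digamma x := by
  rw [Function.comp_def, deriv.log (Real.differentiableAt_Gamma fun m ↦ by
    have : (0 : ℝ) ≤ m := m.cast_nonneg
    linarith) (Real.Gamma_pos_of_pos hx).ne', digamma]

theorem differentiableAt_log_comp_Gamma {x : ℝ} (hx : 0 < x) :
    DifferentiableAt ℝ (Real.log ∘ Real.Gamma) x :=
  (Real.differentiableAt_Gamma fun m ↦ by
    have : (0 : ℝ) ≤ m := m.cast_nonneg
    linarith).log (Real.Gamma_pos_of_pos hx).ne'

theorem log_Gamma_add_one {x : ℝ} (hx : 0 < x) :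
    (Real.log ∘ Real.Gamma) (x + 1) = (Real.log ∘ Real.Gamma) x + Real.log x := by
  simp only [Function.comp_apply, Real.Gamma_add_one hx.ne',
    Real.log_mul hx.ne' (Real.Gamma_pos_of_pos hx).ne', add_comm]

theorem digamma_add_one {x : ℝ} (hx : 0 < x) : digamma (x + 1) = digamma x + 1 / x := by
  rw [← deriv_log_comp_Gamma hx, ← deriv_log_comp_Gamma (by positivity), ← deriv_comp_add_const,
    one_div, ← Real.deriv_log,
    ← deriv_add (differentiableAt_log_comp_Gamma hx) (Real.differentiableAt_log hx.ne')]
  apply Filter.EventuallyEq.deriv_eq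
  filter_upwards [eventually_gt_nhds hx] with y hy using log_Gamma_add_one hy

theorem digamma_add_nat {x : ℝ} (hx : 0 < x) (n : ℕ) :
    digamma (x + n) = digamma x + ∑ k ∈ Finset.range n, 1 / (x + k) := by
  induction n with
  | zero => simp
  | succ n ih =>
    rw [Finset.sum_range_succ, Nat.cast_succ, ← add_assoc, digamma_add_one (by positivity), ih,
      add_assoc]

theorem digamma_le_log {x : ℝ} (hx : 0 < x) : digamma x ≤ Real.log x := by
  rw [← deriv_log_comp_Gamma hx]
  refine (Real.convexOn_log_Gamma.deriv_le_slope (Set.mem_Ioi.mpr hx)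
    (Set.mem_Ioi.mpr (by positivity : 0 < x + 1)) (by linarith)
    (differentiableAt_log_comp_Gamma hx)).trans_eq ?_
  rw [slope_def_field, log_Gamma_add_one hx]
  ring

theorem log_le_digamma_add_one {x : ℝ} (hx : 0 < x) : Real.log x ≤ digamma (x + 1) := by
  have hx' : 0 < x + 1 := by positivity
  rw [← deriv_log_comp_Gamma hx']
  refine Eq.trans_le ?_ (Real.convexOn_log_Gamma.slope_le_deriv (Set.mem_Ioi.mpr hx)
    (Set.mem_Ioi.mpr hx') (by linarith) (differentiableAt_log_comp_Gamma hx'))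
  rw [slope_def_field, log_Gamma_add_one hx]
  ring

open Filter Topology in
theorem tendsto_digamma_sub_log :
    Tendsto (fun x ↦ digamma x - Real.log x) atTop (𝓝 0) := by
  have h : Tendsto (fun x : ℝ ↦ -x⁻¹) atTop (𝓝 0) := by
    simpa using (tendsto_inv_atTop_zero (𝕜 := ℝ)).neg
  refine tendsto_of_tendsto_of_tendsto_of_le_of_le' h tendsto_const_nhds ?_ ?_
  · filter_upwards [eventually_gt_atTop 0] with x hx
    have := log_le_digamma_add_one hx
    rw [digamma_add_one hx, one_div] at this
    linarith
  · filter_upwards [eventually_gt_atTop 0] with x hx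
    linarith [digamma_le_log hx]

open Filter Topology in
theorem tendsto_sum_one_div_sub_harmonic {x : ℝ} (hx : 0 < x) :
    Tendsto (fun n : ℕ ↦ ∑ k ∈ Finset.range n, 1 / (x + k) - (harmonic n : ℝ)) atTop
      (𝓝 (-Real.eulerMascheroniConstant - digamma x)) := by
  have hγ := Real.tendsto_harmonic_sub_log
  have hlog := (Real.tendsto_log_comp_add_sub_log x).comp tendsto_natCast_atTop_atTop
  have hψ := tendsto_digamma_sub_log.comp
    (tendsto_atTop_add_const_left atTop x tendsto_natCast_atTop_atTop)
  have := ((hψ.add hlog).sub hγ).sub_const (digamma x)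
  rw [add_zero, zero_sub] at this
  refine this.congr fun n ↦ ?_
  simp only [Function.comp_apply, digamma_add_nat hx, add_comm (n : ℝ) x]
  ring

/-- Partial fractions for the terms of the generating function of `u`, summed. -/
theorem sum_range_partial_fractions {z : ℝ} (hz : |z| < 1) (n : ℕ) :
    ∑ j ∈ Finset.range n, 2 * ((j : ℝ) + 1) / ((1 - z + j) * (j + 2) * (j + 3)) =
      2 * z / ((1 + z) * (2 + z)) *
          (∑ k ∈ Finset.range n, 1 / (1 - z + k) - (harmonic n : ℝ)) +
        2 / (1 + z) * (1 - 1 / ((n : ℝ) + 1)) * (-1) +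
        4 / (2 + z) * (3 / 2 - 1 / ((n : ℝ) + 1) - 1 / ((n : ℝ) + 1 + 1)) := by
  obtain ⟨h₁, h₂⟩ := abs_lt.mp hz
  have : 1 + z ≠ 0 := by linarith
  have : 2 + z ≠ 0 := by linarith
  induction n with
  | zero => norm_num
  | succ n ih =>
    have : 1 - z + n ≠ 0 := by
      have : (0 : ℝ) ≤ n := n.cast_nonneg
      linarith
    have : (n : ℝ) + 1 ≠ 0 := by positivity
    have : (n : ℝ) + 1 + 1 ≠ 0 := by positivity
    have : (n : ℝ) + 1 + 1 + 1 ≠ 0 := by positivity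
    rw [Finset.sum_range_succ, ih, Finset.sum_range_succ, harmonic_succ]
    push_cast
    rw [show (n : ℝ) + 2 = n + 1 + 1 by ring, show (n : ℝ) + 3 = n + 1 + 1 + 1 by ring]
    generalize ∑ k ∈ Finset.range n, 1 / (1 - z + k) = S
    generalize (harmonic n : ℝ) = H
    field_simp
    ring

open Filter Topology in
theorem hasSum_partial_fractions {z : ℝ} (hz : |z| < 1) :
    HasSum (fun j : ℕ ↦ 2 * ((j : ℝ) + 1) / ((1 - z + j) * (j + 2) * (j + 3)))
      (2 / ((1 + z) * (2 + z)) *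
        (1 + (2 - Real.eulerMascheroniConstant - digamma (1 - z)) * z)) := by
  obtain ⟨h₁, h₂⟩ := abs_lt.mp hz
  have hpos : 0 < 1 - z := by linarith
  have : 1 + z ≠ 0 := by linarith
  have : 2 + z ≠ 0 := by linarith
  rw [hasSum_iff_tendsto_nat_of_nonneg fun j ↦ by positivity]
  simp_rw [sum_range_partial_fractions hz]
  have h0 := tendsto_one_div_add_atTop_nhds_zero_nat (𝕜 := ℝ)
  have h1 : Tendsto (fun n : ℕ ↦ 1 / ((n : ℝ) + 1 + 1)) atTop (𝓝 0) := by
    simpa [Function.comp_def] using h0.comp (tendsto_add_atTop_nat 1)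
  convert (((tendsto_sum_one_div_sub_harmonic hpos).const_mul (2 * z / ((1 + z) * (2 + z)))).add
    (((h0.const_sub 1).const_mul (2 / (1 + z))).mul_const (-1))).add
    (((h0.const_sub (3 / 2)).sub h1).const_mul (4 / (2 + z))) using 2
  field_simp
  ring

theorem hasSum_geometric_term {z : ℝ} (hz : |z| < 1) (j : ℕ) :
    HasSum (fun k : ℕ ↦ 2 / (((j : ℝ) + 1) ^ k * ((j : ℝ) + 2) * ((j : ℝ) + 3)) * z ^ k)
      (2 * ((j : ℝ) + 1) / ((1 - z + j) * (j + 2) * (j + 3))) := by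
  have hj : (0 : ℝ) < j + 1 := by positivity
  obtain ⟨h₁, h₂⟩ := abs_lt.mp hz
  have hne : 1 - z + j ≠ 0 := by linarith [(Nat.cast_nonneg j : (0 : ℝ) ≤ j)]
  have hlt : |z / (j + 1)| < 1 := by
    rw [abs_div, abs_of_pos hj, div_lt_one hj]
    linarith [(Nat.cast_nonneg j : (0 : ℝ) ≤ j)]
  have hval : 2 / (((j : ℝ) + 2) * (j + 3)) * (1 - z / (j + 1))⁻¹ =
      2 * ((j : ℝ) + 1) / ((1 - z + j) * (j + 2) * (j + 3)) := by
    rw [show 1 - z / ((j : ℝ) + 1) = (1 - z + j) / (j + 1) by field_simp; ring]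
    field_simp
  rw [← hval]
  refine ((hasSum_geometric_of_abs_lt_one hlt).mul_left
    (2 / (((j : ℝ) + 2) * (j + 3)))).congr_fun fun k ↦ ?_
  rw [div_pow]
  field_simp

theorem summable_two_div_add_two_mul_add_three :
    Summable fun j : ℕ ↦ 2 / (((j : ℝ) + 2) * ((j : ℝ) + 3)) := by
  refine (hasSum_partial_fractions (z := 0) (by simp)).summable.congr fun j ↦ ?_
  have : (j : ℝ) + 1 ≠ 0 := by positivity
  rw [sub_zero, add_comm 1 (j : ℝ)]
  field_simp

theorem summable_uncurry_u_term {z : ℝ} (hz : |z| < 1) :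
    Summable (Function.uncurry fun j k : ℕ ↦
      2 / (((j : ℝ) + 1) ^ k * ((j : ℝ) + 2) * ((j : ℝ) + 3)) * z ^ k) := by
  refine Summable.of_norm_bounded
    (summable_two_div_add_two_mul_add_three.mul_of_nonneg
      (summable_geometric_of_lt_one (abs_nonneg z) hz)
      (fun j ↦ by positivity) (fun k ↦ pow_nonneg (abs_nonneg z) k)) ?_
  rintro ⟨j, k⟩
  have hnonneg : 0 ≤ 2 / (((j : ℝ) + 1) ^ k * ((j : ℝ) + 2) * ((j : ℝ) + 3)) := by positivity
  rw [Function.uncurry_apply_pair, norm_mul, norm_pow, Real.norm_eq_abs z,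
    Real.norm_of_nonneg hnonneg]
  dsimp only
  have : (1 : ℝ) ≤ (j + 1) ^ k := one_le_pow₀ (by linarith [(Nat.cast_nonneg j : (0 : ℝ) ≤ j)])
  gcongr
  exact le_mul_of_one_le_left (by positivity) this

theorem stmt2 (z : ℝ) (hz : |z| < 1) :
    ∑' k : ℕ, u k * z ^ k =
      2 / ((1 + z) * (2 + z)) *
        (1 + (2 - Real.eulerMascheroniConstant - digamma (1 - z)) * z) := by
  simp_rw [u, ← tsum_mul_right]
  rw [(summable_uncurry_u_term hz).tsum_comm, ← (hasSum_partial_fractions hz).tsum_eq]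
  exact tsum_congr fun j ↦ (hasSum_geometric_term hz j).tsum_eq
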